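/- For every even integer m ≥ 10 there exists a decentralized linear code of length ℓ = 3·⌊m/8⌋ + (m mod 8)/2 for parameters (m, s = 4) that is both correct and secure (here m mod 8 is even, so (m mod 8)/2 is an integer). -/

import Mathlib

namespace SDPicod

/-- Side information set of user `i`: the `s` cyclically consecutive message
indices ending at `i`, i.e. `{i - k : k ∈ Finset.range s}`. -/
def sideInfo (m s : ℕ) (i : ZMod m) : Set (ZMod m) :=
  {j | ∃ k ∈ Finset.range s, j = i - (k : ZMod m)}

/-- A decentralized linear code: every row is encodable by some user, i.e.
its support is contained in that user's side information set. -/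
def IsDecentralizedCode (m s : ℕ) {ℓ : ℕ} (G : Fin ℓ → ZMod m → ZMod 2) : Prop :=
  ∀ t : Fin ℓ, ∃ i : ZMod m, Function.support (G t) ⊆ sideInfo m s i

/-- The set of message indices user `i` can decode: indices `j` outside the
side information set such that the standard basis vector `e j` lies in the
`GF(2)`-span of the rows of `G` together with the basis vectors of the
side information set. -/
def decSet (m s : ℕ) {ℓ : ℕ} (G : Fin ℓ → ZMod m → ZMod 2) (i : ZMod m) :
    Set (ZMod m) :=
  {j | j ∉ sideInfo m s i ∧
    Pi.single j (1 : ZMod 2) ∈ Submodule.span (ZMod 2)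
      (Set.range G ∪ {v | ∃ k ∈ sideInfo m s i, v = Pi.single k (1 : ZMod 2)})}

/-- Correctness: every user can decode at least one new message. -/
def Correct (m s : ℕ) {ℓ : ℕ} (G : Fin ℓ → ZMod m → ZMod 2) : Prop :=
  ∀ i : ZMod m, (decSet m s G i).Nonempty

/-- Security: no user can decode more than one new message. -/
def Secure (m s : ℕ) {ℓ : ℕ} (G : Fin ℓ → ZMod m → ZMod 2) : Prop :=
  ∀ i : ZMod m, (decSet m s G i).Subsingleton

end SDPicod

open SDPicod

namespace SDPicod

/-- The window condition `j ∈ sideInfo m 4 i` in terms of the representatives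
`a` of `i` and `n` of `j`. -/
def InWindow (m a n : ℕ) : Prop :=
  (n ≤ a ∧ a < n + 4) ∨ a + m < n + 4

/-- Membership of `n` in the support of row `t`: the first `q` blocks of eight indices
carry the rows `{1, 2}`, `{3, 5}`, `{6, 7}`, and every following block of two indices carries
one row consisting of the block and the cyclically next index. -/
def RowMem (m q t n : ℕ) : Prop :=
  (t < 3 * q ∧
    ((t % 3 = 0 ∧ (n = 8 * (t / 3) + 1 ∨ n = 8 * (t / 3) + 2)) ∨
     (t % 3 = 1 ∧ (n = 8 * (t / 3) + 3 ∨ n = 8 * (t / 3) + 5)) ∨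
     (t % 3 = 2 ∧ (n = 8 * (t / 3) + 6 ∨ n = 8 * (t / 3) + 7)))) ∨
  (3 * q ≤ t ∧
    (n = 8 * q + 2 * (t - 3 * q) ∨ n = 8 * q + 2 * (t - 3 * q) + 1 ∨
     n = 8 * q + 2 * (t - 3 * q) + 2 ∨ n + m = 8 * q + 2 * (t - 3 * q) + 2))

/-- The representative, up to a multiple of `m`, of the message decoded by user `a`. -/
def targetAux (m q a : ℕ) : ℕ :=
  if a < 8 * q then
    if a % 8 = 0 then (if a = 0 ∧ 8 * q < m then a + m - 4 else a + m - 5)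
    else if a % 8 = 1 ∨ a % 8 = 4 ∨ a % 8 = 6 then a + 1
    else if a % 8 = 3 then a + 2
    else a + m - 4
  else if a = 8 * q then a + m - 5
  else if a % 2 = 0 then a + m - 4
  else a + 1

/-- The representative in `[0, m)` of the message decoded by user `a`. -/
def target (m q a : ℕ) : ℕ :=
  if targetAux m q a < m then targetAux m q a else targetAux m q a - m

lemma target_lt {m q r a : ℕ} (hm : m = 8 * q + 2 * r) (h10 : 10 ≤ m) (ha : a < m) :
    target m q a < m := by
  unfold target targetAux
  split_ifs <;> omega

lemma not_inWindow_target {m q r a : ℕ} (hm : m = 8 * q + 2 * r) (h10 : 10 ≤ m) (ha : a < m) :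
    ¬ InWindow m a (target m q a) := by
  unfold InWindow target targetAux
  split_ifs <;> omega

lemma exists_row_target {m q r a : ℕ} (hm : m = 8 * q + 2 * r) (h10 : 10 ≤ m) (hq : 1 ≤ q)
    (ha : a < m) :
    ∃ t < 3 * q + r, RowMem m q t (target m q a) ∧
      ∀ n < m, RowMem m q t n → n = target m q a ∨ InWindow m a n := by
  have key (t : ℕ) (ht : t < 3 * q + r) (n : ℕ) (hn : target m q a = n) (h : RowMem m q t n)
      (h' : ∀ k < m, RowMem m q t k → k = n ∨ InWindow m a k) :
      ∃ t < 3 * q + r, RowMem m q t (target m q a) ∧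
        ∀ n < m, RowMem m q t n → n = target m q a ∨ InWindow m a n :=
    ⟨t, ht, hn ▸ h, hn ▸ h'⟩
  unfold target targetAux RowMem InWindow at key
  unfold target targetAux RowMem InWindow
  by_cases h0 : a < 8 * q
  · obtain ⟨b, c, rfl, hc⟩ : ∃ b c, a = 8 * b + c ∧ c < 8 :=
      ⟨a / 8, a % 8, by omega, Nat.mod_lt _ (by norm_num)⟩
    interval_cases c
    · by_cases hb : b = 0
      · subst hb
        by_cases hr : r = 0
        · exact key (3 * q - 2) (by omega) (8 * q - 5) (by split_ifs <;> omega)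
            (by omega) (by omega)
        · exact key (3 * q + r - 2) (by omega) (m - 4) (by split_ifs <;> omega)
            (by omega) (by omega)
      · exact key (3 * b - 2) (by omega) (8 * b - 5) (by split_ifs <;> omega) (by omega) (by omega)
    · exact key (3 * b) (by omega) (8 * b + 2) (by split_ifs <;> omega) (by omega) (by omega)
    · by_cases hb : b = 0
      · by_cases hr : r = 0
        · exact key (3 * q - 1) (by omega) (m - 2) (by split_ifs <;> omega) (by omega) (by omega)
        · exact key (3 * q + r - 1) (by omega) (m - 2) (by split_ifs <;> omega) (by omega)
            (by omega)
      · exact key (3 * b - 1) (by omega) (8 * b - 2) (by split_ifs <;> omega) (by omega) (by omega)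
    · exact key (3 * b + 1) (by omega) (8 * b + 5) (by split_ifs <;> omega) (by omega) (by omega)
    · exact key (3 * b + 1) (by omega) (8 * b + 5) (by split_ifs <;> omega) (by omega) (by omega)
    · exact key (3 * b) (by omega) (8 * b + 1) (by split_ifs <;> omega) (by omega) (by omega)
    · exact key (3 * b + 2) (by omega) (8 * b + 7) (by split_ifs <;> omega) (by omega) (by omega)
    · exact key (3 * b + 1) (by omega) (8 * b + 3) (by split_ifs <;> omega) (by omega) (by omega)
  · obtain ⟨k, c, rfl, hc⟩ : ∃ k c, a = 8 * q + 2 * k + c ∧ c < 2 :=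
      ⟨(a - 8 * q) / 2, a % 2, by omega, Nat.mod_lt _ (by norm_num)⟩
    interval_cases c
    · by_cases hk : k = 0
      · exact key (3 * q - 2) (by omega) (8 * q - 5) (by split_ifs <;> omega) (by omega) (by omega)
      · exact key (3 * q + k - 2) (by omega) (8 * q + 2 * k - 4) (by split_ifs <;> omega)
          (by omega) (by omega)
    · by_cases hk : k + 1 = r
      · exact key (3 * q + k) (by omega) 0 (by split_ifs <;> omega) (by omega) (by omega)
      · exact key (3 * q + k) (by omega) (8 * q + 2 * k + 2) (by split_ifs <;> omega)
          (by omega) (by omega)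

lemma rowMem_eight_mul_add {m q r t b c : ℕ} (hm : m = 8 * q + 2 * r) (ht : t < 3 * q + r)
    (hb : b < q) (hc : c < 8) (h0 : 8 * b + c ≠ 0) :
    RowMem m q t (8 * b + c) ↔ (t = 3 * b ∧ (c = 1 ∨ c = 2)) ∨
      (t = 3 * b + 1 ∧ (c = 3 ∨ c = 5)) ∨ (t = 3 * b + 2 ∧ (c = 6 ∨ c = 7)) := by
  unfold RowMem
  constructor <;> intro h <;> omega

lemma rowMem_zero {m q r t : ℕ} (hm : m = 8 * q + 2 * r) (hq : 1 ≤ q) (ht : t < 3 * q + r) :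
    RowMem m q t 0 ↔ r ≠ 0 ∧ t + 1 = 3 * q + r := by
  unfold RowMem
  constructor <;> intro h <;> omega

lemma rowMem_even {m q r t k : ℕ} (hm : m = 8 * q + 2 * r) (hq : 1 ≤ q)
    (ht : t < 3 * q + r) :
    RowMem m q t (8 * q + 2 * k) ↔ t = 3 * q + k ∨ (k ≠ 0 ∧ t + 1 = 3 * q + k) := by
  unfold RowMem
  constructor <;> intro h <;> omega

lemma rowMem_odd {m q r t k : ℕ} (hm : m = 8 * q + 2 * r) (hk : k < r) :
    RowMem m q t (8 * q + 2 * k + 1) ↔ t = 3 * q + k := by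
  unfold RowMem
  constructor <;> intro h <;> omega

lemma free_or_pair_of_lt {m q r u n : ℕ} (hm : m = 8 * q + 2 * r) (h10 : 10 ≤ m) (hu : u < m)
    (hn : n < 8 * q) (hne : n ≠ target m q u) (hW : ¬ InWindow m u n) :
    (∀ t < 3 * q + r, ¬ RowMem m q t n) ∨
      ∃ a < m, n ≠ a ∧ ¬ InWindow m u a ∧
        ∀ t < 3 * q + r, (RowMem m q t n ↔ RowMem m q t a) := by
  unfold target targetAux at hne
  unfold InWindow at hW ⊢
  obtain ⟨b, c, rfl, hc⟩ : ∃ b c, n = 8 * b + c ∧ c < 8 :=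
    ⟨n / 8, n % 8, by omega, Nat.mod_lt _ (by norm_num)⟩
  have hb : b < q := by omega
  have row {t d : ℕ} (ht : t < 3 * q + r) := rowMem_eight_mul_add (c := d) hm ht hb
  interval_cases c
  · by_cases hb0 : b = 0
    · subst hb0
      by_cases hr : r = 0
      · refine Or.inl fun t ht => ?_
        rw [rowMem_zero hm hb ht]
        omega
      · obtain ⟨k, rfl⟩ := Nat.exists_eq_succ_of_ne_zero hr
        refine Or.inr ⟨8 * q + 2 * k + 1, by omega, by omega, by split_ifs at hne <;> omega,
          fun t ht => ?_⟩
        rw [rowMem_zero hm hb ht, rowMem_odd hm k.lt_succ_self]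
        omega
    · refine Or.inl fun t ht => ?_
      rw [row ht (by omega) (by omega)]
      omega
  · refine Or.inr ⟨8 * b + 2, by omega, by omega, by split_ifs at hne <;> omega, fun t ht => ?_⟩
    rw [row ht (by omega) (by omega), row ht (by omega) (by omega)]
    omega
  · refine Or.inr ⟨8 * b + 1, by omega, by omega, by split_ifs at hne <;> omega, fun t ht => ?_⟩
    rw [row ht (by omega) (by omega), row ht (by omega) (by omega)]
    omega
  · refine Or.inr ⟨8 * b + 5, by omega, by omega, by split_ifs at hne <;> omega, fun t ht => ?_⟩
    rw [row ht (by omega) (by omega), row ht (by omega) (by omega)]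
    omega
  · refine Or.inl fun t ht => ?_
    rw [row ht (by omega) (by omega)]
    omega
  · refine Or.inr ⟨8 * b + 3, by omega, by omega, by split_ifs at hne <;> omega, fun t ht => ?_⟩
    rw [row ht (by omega) (by omega), row ht (by omega) (by omega)]
    omega
  · refine Or.inr ⟨8 * b + 7, by omega, by omega, by split_ifs at hne <;> omega, fun t ht => ?_⟩
    rw [row ht (by omega) (by omega), row ht (by omega) (by omega)]
    omega
  · refine Or.inr ⟨8 * b + 6, by omega, by omega, by split_ifs at hne <;> omega, fun t ht => ?_⟩
    rw [row ht (by omega) (by omega), row ht (by omega) (by omega)]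
    omega

lemma pair_or_triple_of_ge {m q r u n : ℕ} (hm : m = 8 * q + 2 * r) (h10 : 10 ≤ m)
    (hq : 1 ≤ q) (hu : u < m) (hn : n < m) (hn' : 8 * q ≤ n) (hne : n ≠ target m q u)
    (hW : ¬ InWindow m u n) :
    (∃ a < m, n ≠ a ∧ ¬ InWindow m u a ∧
      ∀ t < 3 * q + r, (RowMem m q t n ↔ RowMem m q t a)) ∨
    ∃ a < m, ∃ b < m, n ≠ a ∧ n ≠ b ∧ ¬ InWindow m u a ∧ ¬ InWindow m u b ∧
      ∀ t < 3 * q + r, (RowMem m q t n ↔ ¬ (RowMem m q t a ↔ RowMem m q t b)) := by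
  unfold target targetAux at hne
  unfold InWindow at hW ⊢
  obtain ⟨k, c, rfl, hc⟩ : ∃ k c, n = 8 * q + 2 * k + c ∧ c < 2 :=
    ⟨(n - 8 * q) / 2, n % 2, by omega, Nat.mod_lt _ (by norm_num)⟩
  have hk : k < r := by omega
  interval_cases c
  · rw [add_zero] at *
    rcases k with _ | k
    · refine Or.inl ⟨8 * q + 2 * 0 + 1, by omega, by omega, by split_ifs at hne <;> omega,
        fun t ht => ?_⟩
      rw [rowMem_even hm hq ht, rowMem_odd hm hk]
      omega
    · refine Or.inr ⟨8 * q + 2 * k + 1, by omega, 8 * q + 2 * (k + 1) + 1, by omega, by omega,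
        by omega, by split_ifs at hne <;> omega, by split_ifs at hne <;> omega, fun t ht => ?_⟩
      rw [rowMem_even hm hq ht, rowMem_odd hm hk, rowMem_odd hm (by omega)]
      omega
  · clear hne
    by_cases hl : u + 1 = 8 * q + 2 * k + 1 ∨ u + 2 = 8 * q + 2 * k + 1
    · by_cases hkr : k + 1 = r
      · refine Or.inl ⟨0, by omega, by omega, by omega, fun t ht => ?_⟩
        rw [rowMem_odd hm hk, rowMem_zero hm hq ht]
        omega
      · refine Or.inr ⟨8 * q + 2 * (k + 1), by omega, 8 * q + 2 * (k + 1) + 1, by omega, by omega,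
          by omega, by omega, by omega, fun t ht => ?_⟩
        rw [rowMem_odd hm hk, rowMem_even hm hq ht, rowMem_odd hm (by omega)]
        omega
    · rcases k with _ | k
      · refine Or.inl ⟨8 * q + 2 * 0, by omega, by omega, by omega, fun t ht => ?_⟩
        rw [rowMem_odd hm hk, rowMem_even hm hq ht]
        omega
      · refine Or.inr ⟨8 * q + 2 * (k + 1), by omega, 8 * q + 2 * k + 1, by omega, by omega,
          by omega, by omega, by omega, fun t ht => ?_⟩
        rw [rowMem_odd hm hk, rowMem_even hm hq ht, rowMem_odd hm (by omega)]
        omega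

lemma exists_window_of_row {m q r t : ℕ} (hm : m = 8 * q + 2 * r) (h10 : 10 ≤ m)
    (ht : t < 3 * q + r) : ∃ a < m, ∀ n < m, RowMem m q t n → InWindow m a n := by
  unfold RowMem InWindow
  by_cases h : t < 3 * q
  · exact ⟨8 * (t / 3) + 2 * (t % 3) + 3, by omega, by omega⟩
  · by_cases h' : 8 * q + 2 * (t - 3 * q) + 2 < m
    · exact ⟨_, h', by omega⟩
    · exact ⟨0, by omega, by omega⟩

lemma mem_sideInfo_iff {m : ℕ} [NeZero m] (h4 : 4 ≤ m) (i j : ZMod m) :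
    j ∈ sideInfo m 4 i ↔ InWindow m i.val j.val := by
  have hi := ZMod.val_lt i
  have hj := ZMod.val_lt j
  constructor
  · rintro ⟨k, hk, rfl⟩
    rw [Finset.mem_range] at hk
    have hk' : ((k : ZMod m)).val = k := ZMod.val_cast_of_lt (by omega)
    unfold InWindow
    have h : (i - k + k : ZMod m).val = i.val := by rw [sub_add_cancel]
    rw [ZMod.val_add, hk'] at h
    rcases lt_or_ge ((i - k : ZMod m).val + k) m with h' | h'
    · rw [Nat.mod_eq_of_lt h'] at h
      omega
    · rw [Nat.mod_eq_sub_mod h', Nat.mod_eq_of_lt (by omega)] at h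
      omega
  · intro h
    have hi' : ((i.val : ℕ) : ZMod m) = i := ZMod.natCast_zmod_val i
    have hj' : ((j.val : ℕ) : ZMod m) = j := ZMod.natCast_zmod_val j
    rcases h with h | h
    · refine ⟨i.val - j.val, Finset.mem_range.2 (by omega), ?_⟩
      rw [Nat.cast_sub h.1, hi', hj', sub_sub_cancel]
    · refine ⟨i.val + m - j.val, Finset.mem_range.2 (by omega), ?_⟩
      rw [Nat.cast_sub (by omega), Nat.cast_add, hi', hj', ZMod.natCast_self, add_zero,
        sub_sub_cancel]

/-- A linear functional that vanishes on the code and on the side information of user `i`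
certifies that user `i` cannot decode `j`. -/
lemma notMem_decSet_of_functional {m s ℓ : ℕ} {G : Fin ℓ → ZMod m → ZMod 2} {i j : ZMod m}
    (φ : (ZMod m → ZMod 2) →ₗ[ZMod 2] ZMod 2) (hG : ∀ t, φ (G t) = 0)
    (hW : ∀ k ∈ sideInfo m s i, φ (Pi.single k 1) = 0) (hj : φ (Pi.single j 1) ≠ 0) :
    j ∉ decSet m s G i := by
  rintro ⟨-, h⟩
  have hle : Submodule.span (ZMod 2)
      (Set.range G ∪ {v | ∃ k ∈ sideInfo m s i, v = Pi.single k (1 : ZMod 2)}) ≤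
      LinearMap.ker φ := by
    rw [Submodule.span_le]
    rintro v (⟨t, rfl⟩ | ⟨k, hk, rfl⟩)
    · exact hG t
    · exact hW k hk
  exact hj (hle h)

/-- A row whose support consists of `j` and side information lets user `i` decode `j`. -/
lemma mem_decSet_of_row {m s ℓ : ℕ} [NeZero m] {G : Fin ℓ → ZMod m → ZMod 2} {i j : ZMod m}
    (t : Fin ℓ) (hj : j ∉ sideInfo m s i) (ht : G t j = 1)
    (h : ∀ k, G t k ≠ 0 → k = j ∨ k ∈ sideInfo m s i) : j ∈ decSet m s G i := by
  refine ⟨hj, ?_⟩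
  set V := Submodule.span (ZMod 2)
    (Set.range G ∪ {v | ∃ k ∈ sideInfo m s i, v = Pi.single k (1 : ZMod 2)})
  have hsum : G t = G t j • Pi.single j 1 +
      ∑ k ∈ Finset.univ.erase j, G t k • Pi.single k (1 : ZMod 2) := by
    rw [Finset.add_sum_erase _ (fun k => G t k • Pi.single k (1 : ZMod 2)) (Finset.mem_univ j)]
    exact pi_eq_sum_univ' (G t)
  rw [ht, one_smul] at hsum
  rw [eq_sub_of_add_eq hsum.symm]
  refine V.sub_mem (Submodule.subset_span (Or.inl ⟨t, rfl⟩)) (V.sum_mem fun k hk => ?_)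
  by_cases hk0 : G t k = 0
  · rw [hk0, zero_smul]
    exact V.zero_mem
  · refine V.smul_mem _ (Submodule.subset_span (Or.inr ⟨k, ?_, rfl⟩))
    exact (h k hk0).resolve_left (Finset.ne_of_mem_erase hk)

open Classical in
/-- The code with rows described by `RowMem`. -/
noncomputable def blockCode (m q ℓ : ℕ) (t : Fin ℓ) (j : ZMod m) : ZMod 2 :=
  if RowMem m q t j.val then 1 else 0

section Security

variable {m q ℓ : ℕ} [NeZero m]

lemma notMem_decSet_of_free (h4 : 4 ≤ m) {i : ZMod m} {n : ℕ} (hn : n < m)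
    (hW : ¬ InWindow m i.val n) (hrow : ∀ t < ℓ, ¬ RowMem m q t n) :
    (n : ZMod m) ∉ decSet m 4 (blockCode m q ℓ) i := by
  have hv := ZMod.val_cast_of_lt hn
  refine notMem_decSet_of_functional (LinearMap.proj (n : ZMod m)) (fun t => ?_)
    (fun k hk => ?_) ?_
  · simp [blockCode, hv, hrow t t.2]
  · rw [mem_sideInfo_iff h4] at hk
    have : k ≠ n := by rintro rfl; exact hW (hv ▸ hk)
    simp [this.symm]
  · simp

lemma notMem_decSet_of_pair (h4 : 4 ≤ m) {i : ZMod m} {n a : ℕ} (hn : n < m) (ha : a < m)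
    (hna : n ≠ a) (hW : ¬ InWindow m i.val n) (hWa : ¬ InWindow m i.val a)
    (hrow : ∀ t < ℓ, (RowMem m q t n ↔ RowMem m q t a)) :
    (n : ZMod m) ∉ decSet m 4 (blockCode m q ℓ) i := by
  have hv := ZMod.val_cast_of_lt hn
  have hva := ZMod.val_cast_of_lt ha
  refine notMem_decSet_of_functional
    (LinearMap.proj (R := ZMod 2) (φ := fun _ => ZMod 2) (n : ZMod m) +
      LinearMap.proj (a : ZMod m)) (fun t => ?_)
    (fun k hk => ?_) ?_
  · by_cases h : RowMem m q t a
    · simp only [LinearMap.add_apply, LinearMap.proj_apply, blockCode, hv, hva, hrow t t.2, h,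
        if_true]
      decide
    · simp [blockCode, hv, hva, hrow t t.2, h]
  · rw [mem_sideInfo_iff h4] at hk
    have h₁ : k ≠ n := by rintro rfl; exact hW (hv ▸ hk)
    have h₂ : k ≠ a := by rintro rfl; exact hWa (hva ▸ hk)
    simp [h₁.symm, h₂.symm]
  · have : (a : ZMod m) ≠ n := fun h => hna (by rw [← hv, ← hva, h])
    simp [this]

lemma notMem_decSet_of_triple (h4 : 4 ≤ m) {i : ZMod m} {n a b : ℕ} (hn : n < m) (ha : a < m)
    (hb : b < m) (hna : n ≠ a) (hnb : n ≠ b) (hW : ¬ InWindow m i.val n)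
    (hWa : ¬ InWindow m i.val a) (hWb : ¬ InWindow m i.val b)
    (hrow : ∀ t < ℓ, (RowMem m q t n ↔ ¬ (RowMem m q t a ↔ RowMem m q t b))) :
    (n : ZMod m) ∉ decSet m 4 (blockCode m q ℓ) i := by
  have hv := ZMod.val_cast_of_lt hn
  have hva := ZMod.val_cast_of_lt ha
  have hvb := ZMod.val_cast_of_lt hb
  refine notMem_decSet_of_functional
    (LinearMap.proj (R := ZMod 2) (φ := fun _ => ZMod 2) (n : ZMod m) +
      LinearMap.proj (a : ZMod m) + LinearMap.proj (b : ZMod m))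
    (fun t => ?_) (fun k hk => ?_) ?_
  · by_cases h : RowMem m q t a <;> by_cases h' : RowMem m q t b <;>
      simp [blockCode, hv, hva, hvb, hrow t t.2, h, h'] <;> decide
  · rw [mem_sideInfo_iff h4] at hk
    have h₁ : k ≠ n := by rintro rfl; exact hW (hv ▸ hk)
    have h₂ : k ≠ a := by rintro rfl; exact hWa (hva ▸ hk)
    have h₃ : k ≠ b := by rintro rfl; exact hWb (hvb ▸ hk)
    simp [h₁.symm, h₂.symm, h₃.symm]
  · have h₁ : (a : ZMod m) ≠ n := fun h => hna (by rw [← hv, ← hva, h])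
    have h₂ : (b : ZMod m) ≠ n := fun h => hnb (by rw [← hv, ← hvb, h])
    simp [h₁, h₂]

end Security

lemma eq_target_of_mem_decSet {m q r : ℕ} [NeZero m] (hm : m = 8 * q + 2 * r) (h10 : 10 ≤ m)
    (hq : 1 ≤ q) {i j : ZMod m} (hj : j ∈ decSet m 4 (blockCode m q (3 * q + r)) i) :
    j.val = target m q i.val := by
  have h4 : 4 ≤ m := by omega
  have hi := ZMod.val_lt i
  have hn := ZMod.val_lt j
  have hW := (mem_sideInfo_iff h4 i j).not.1 hj.1
  by_contra hne
  rw [← ZMod.natCast_zmod_val j] at hj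
  rcases lt_or_ge j.val (8 * q) with h | h
  · rcases free_or_pair_of_lt hm h10 hi h hne hW with hrow | ⟨a, ha, hna, hWa, hrow⟩
    · exact notMem_decSet_of_free h4 hn hW hrow hj
    · exact notMem_decSet_of_pair h4 hn ha hna hW hWa hrow hj
  · rcases pair_or_triple_of_ge hm h10 hq hi hn h hne hW with
      ⟨a, ha, hna, hWa, hrow⟩ | ⟨a, ha, b, hb, hna, hnb, hWa, hWb, hrow⟩
    · exact notMem_decSet_of_pair h4 hn ha hna hW hWa hrow hj
    · exact notMem_decSet_of_triple h4 hn ha hb hna hnb hW hWa hWb hrow hj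

theorem blockCode_feasible {m q r : ℕ} [NeZero m] (hm : m = 8 * q + 2 * r) (h10 : 10 ≤ m)
    (hq : 1 ≤ q) :
    IsDecentralizedCode m 4 (blockCode m q (3 * q + r)) ∧
      Correct m 4 (blockCode m q (3 * q + r)) ∧ Secure m 4 (blockCode m q (3 * q + r)) := by
  refine ⟨fun t => ?_, fun i => ?_, fun i j hj k hk => ?_⟩
  · obtain ⟨a, ha, h⟩ := exists_window_of_row hm h10 t.2
    refine ⟨(a : ZMod m), fun j hj => ?_⟩
    rw [mem_sideInfo_iff (by omega), ZMod.val_cast_of_lt ha]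
    refine h _ (ZMod.val_lt j) ?_
    by_contra hr
    exact hj (if_neg hr)
  · have hi := ZMod.val_lt i
    have hlt := target_lt hm h10 hi
    obtain ⟨t, ht, hrow, h⟩ := exists_row_target hm h10 hq hi
    have hv := ZMod.val_cast_of_lt hlt
    refine ⟨(target m q i.val : ZMod m), mem_decSet_of_row ⟨t, ht⟩ ?_ ?_ fun k hk => ?_⟩
    · rw [mem_sideInfo_iff (by omega), hv]
      exact not_inWindow_target hm h10 hi
    · simp [blockCode, hv, hrow]
    · have hr : RowMem m q t k.val := by
        by_contra hr
        exact hk (if_neg hr)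
      rw [mem_sideInfo_iff (by omega)]
      refine (h _ (ZMod.val_lt k) hr).imp_left fun h => ?_
      rw [← h, ZMod.natCast_zmod_val]
  · exact ZMod.val_injective m
      ((eq_target_of_mem_decSet hm h10 hq hj).trans (eq_target_of_mem_decSet hm h10 hq hk).symm)

end SDPicod

theorem feasible_s_eq_four_even (m : ℕ) (hm : 10 ≤ m) (heven : Even m) :
    ∃ G : Fin (3 * (m / 8) + (m % 8) / 2) → ZMod m → ZMod 2,
      IsDecentralizedCode m 4 G ∧ Correct m 4 G ∧ Secure m 4 G := by
  have : NeZero m := ⟨by omega⟩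
  obtain ⟨c, hc⟩ := heven
  exact ⟨_, blockCode_feasible (q := m / 8) (r := m % 8 / 2) (by omega) hm (by omega)⟩
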